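/- arXiv:1609.02380 — 2 statements merged into one kernel-verified Lean document; each statement's English description precedes it below -/
import Mathlib

section
/- Let the finite group A act by automorphisms on the finite group G and let K be an (A,𝒫)-component of G. Then K is a normal subgroup of its normal closure ⟨K^G⟩. -/
open Pointwise

namespace PaperPF
set_option linter.unusedVariables false

/-- A subgroup `K` is subnormal if there is a finite chain
`K = K₀ ⊴ K₁ ⊴ ⋯ ⊴ Kₙ = G` with each term normal in the next. -/
def IsSubnormal {G : Type} [Group G] (K : Subgroup G) : Prop :=
  ∃ (n : ℕ) (c : Fin (n + 1) → Subgroup G),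
    c 0 = K ∧ c (Fin.last n) = ⊤ ∧
      ∀ i : Fin n, c i.castSucc ≤ c i.succ ∧ ((c i.castSucc).subgroupOf (c i.succ)).Normal

/-- A finite group is quasisimple if it is perfect and its central quotient is a
nonabelian simple group. -/
def IsQuasisimple (X : Type) [Group X] : Prop :=
  commutator X = ⊤ ∧ IsSimpleGroup (X ⧸ Subgroup.center X) ∧
    ∃ a b : X ⧸ Subgroup.center X, a * b ≠ b * a

/-- A component: a quasisimple subnormal subgroup. -/
def IsComponent {G : Type} [Group G] (K : Subgroup G) : Prop :=
  IsSubnormal K ∧ IsQuasisimple ↥K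

/-- The subgroup generated by a family of subgroups. -/
def genBy {G : Type} [Group G] (S : Set (Subgroup G)) : Subgroup G :=
  Subgroup.closure (⋃ N ∈ S, (N : Set G))

theorem genBy_normal {G : Type} [Group G] {S : Set (Subgroup G)}
    (h : ∀ N ∈ S, N.Normal) : (genBy S).Normal := by
  constructor
  intro x hx g
  have hmap : Subgroup.map (MulAut.conj g).toMonoidHom (genBy S) ≤ genBy S := by
    rw [genBy, MonoidHom.map_closure]
    apply Subgroup.closure_mono
    rintro y ⟨z, hz, rfl⟩
    simp only [Set.mem_iUnion] at hz ⊢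
    obtain ⟨N, hN, hzN⟩ := hz
    exact ⟨N, hN, (h N hN).conj_mem z hzN g⟩
  exact hmap ⟨x, hx, rfl⟩

/-- `O_𝒫(G)`: the subgroup generated by all normal `𝒫`-subgroups. -/
def Op (P : (X : Type) → [inst : Group X] → Prop) (G : Type) [Group G] : Subgroup G :=
  genBy {N : Subgroup G | N.Normal ∧ P ↥N}

instance Op_normal (P : (X : Type) → [inst : Group X] → Prop) (G : Type) [Group G] :
    (Op P G).Normal :=
  genBy_normal fun _ hN => hN.1

/-- `N` is normal with `𝒫` quotient. -/
def QuotIsP (P : (X : Type) → [inst : Group X] → Prop) {G : Type} [Group G]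
    (N : Subgroup G) : Prop :=
  ∃ h : N.Normal, haveI := h; P (G ⧸ N)

/-- `O^𝒫(G)`: the intersection of all normal subgroups with `𝒫` quotient. -/
def Oup (P : (X : Type) → [inst : Group X] → Prop) (G : Type) [Group G] : Subgroup G :=
  ⨅ (N : Subgroup G) (_ : QuotIsP P N), N

/-- A `𝒫`-component. -/
def IsPComponent (P : (X : Type) → [inst : Group X] → Prop) {G : Type} [Group G]
    (K : Subgroup G) : Prop :=
  IsSubnormal K ∧ IsQuasisimple (↥K ⧸ Op P ↥K) ∧ Oup P ↥K = ⊤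

/-- The solvable radical. -/
def solRad (G : Type) [Group G] : Subgroup G :=
  genBy {N : Subgroup G | N.Normal ∧ IsSolvable ↥N}

/-- `O_{𝒫,E}(G) = O_𝒫(G) · L_𝒫(G)`. -/
def OPE (P : (X : Type) → [inst : Group X] → Prop) (G : Type) [Group G] : Subgroup G :=
  Op P G ⊔ sSup {K : Subgroup G | IsPComponent P K}



/-- The subgroup of points fixed by a single element `a`. -/
def fixedBySub {A : Type} (G : Type) [Monoid A] [Group G] [MulDistribMulAction A G]
    (a : A) : Subgroup G where
  carrier := {x : G | a • x = x}
  one_mem' := smul_one a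
  mul_mem' := fun {x y} hx hy => by
    show a • (x * y) = x * y
    rw [smul_mul', hx, hy]
  inv_mem' := fun {x} hx => by
    show a • x⁻¹ = x⁻¹
    rw [smul_inv', hx]

/-- The subgroup of points fixed by every element of a subgroup `B` of `A`. -/
def fixedOfSub {A : Type} (G : Type) [Group A] [Group G] [MulDistribMulAction A G]
    (B : Subgroup A) : Subgroup G where
  carrier := {x : G | ∀ b ∈ B, b • x = x}
  one_mem' := fun b _ => smul_one b
  mul_mem' := fun {x y} hx hy b hb => by rw [smul_mul', hx b hb, hy b hb]
  inv_mem' := fun {x} hx b hb => by rw [smul_inv', hx b hb]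

/-- The action of `A` restricted to an `A`-invariant subgroup. -/
def invSubAction (A : Type) {G : Type} [Monoid A] [Group G] [MulDistribMulAction A G]
    (K : Subgroup G) (hK : ∀ (a : A) (x : G), x ∈ K → a • x ∈ K) :
    MulDistribMulAction A ↥K where
  smul a x := ⟨a • (x : G), hK a x x.2⟩
  one_smul x := Subtype.ext (one_smul A (x : G))
  mul_smul a b x := Subtype.ext (mul_smul a b (x : G))
  smul_mul a x y := Subtype.ext (smul_mul' a (x : G) (y : G))
  smul_one a := Subtype.ext (smul_one a)

/-- The map induced by `a • ·` on the quotient by an `A`-invariant normal subgroup. -/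
def invQuotSMul (A : Type) {G : Type} [Monoid A] [Group G] [MulDistribMulAction A G]
    (N : Subgroup G) [N.Normal] (hN : ∀ (a : A) (x : G), x ∈ N → a • x ∈ N) (a : A) :
    G ⧸ N → G ⧸ N :=
  Quotient.map' (a • ·) (fun x y h => by
    rw [QuotientGroup.leftRel_apply] at h ⊢
    have := hN a _ h
    rwa [smul_mul', smul_inv'] at this)

theorem invQuotSMul_mk (A : Type) {G : Type} [Monoid A] [Group G] [MulDistribMulAction A G]
    (N : Subgroup G) [N.Normal] (hN : ∀ (a : A) (x : G), x ∈ N → a • x ∈ N) (a : A) (x : G) :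
    invQuotSMul A N hN a (x : G ⧸ N) = ((a • x : G) : G ⧸ N) := rfl

/-- The action of `A` induced on the quotient by an `A`-invariant normal subgroup. -/
def invQuotAction (A : Type) {G : Type} [Monoid A] [Group G] [MulDistribMulAction A G]
    (N : Subgroup G) [N.Normal] (hN : ∀ (a : A) (x : G), x ∈ N → a • x ∈ N) :
    MulDistribMulAction A (G ⧸ N) where
  smul := invQuotSMul A N hN
  one_smul q := QuotientGroup.induction_on q fun x => by
    show invQuotSMul A N hN 1 (x : G ⧸ N) = (x : G ⧸ N)
    rw [invQuotSMul_mk, one_smul]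
  mul_smul a b q := QuotientGroup.induction_on q fun x => by
    show invQuotSMul A N hN (a * b) (x : G ⧸ N)
        = invQuotSMul A N hN a (invQuotSMul A N hN b (x : G ⧸ N))
    rw [invQuotSMul_mk, invQuotSMul_mk, invQuotSMul_mk, mul_smul]
  smul_mul a q r := Quotient.inductionOn₂' q r fun x y => by
    show invQuotSMul A N hN a ((x : G ⧸ N) * (y : G ⧸ N))
        = invQuotSMul A N hN a (x : G ⧸ N) * invQuotSMul A N hN a (y : G ⧸ N)
    rw [← QuotientGroup.mk_mul, invQuotSMul_mk, invQuotSMul_mk, invQuotSMul_mk,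
      ← QuotientGroup.mk_mul, smul_mul']
  smul_one a := by
    show invQuotSMul A N hN a ((1 : G) : G ⧸ N) = ((1 : G) : G ⧸ N)
    rw [invQuotSMul_mk, smul_one]

/-- The action of `A` induced on the central quotient. -/
def centerQuotAction (A : Type) (X : Type) [Group A] [Group X] [MulDistribMulAction A X] :
    MulDistribMulAction A (X ⧸ Subgroup.center X) :=
  invQuotAction A (Subgroup.center X) (fun a x hx => by
    rw [Subgroup.mem_center_iff] at hx ⊢
    intro y
    calc y * a • x = a • (a⁻¹ • y * x) := by rw [smul_mul', smul_inv_smul]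
    _ = a • (x * a⁻¹ • y) := by rw [hx (a⁻¹ • y)]
    _ = a • x * y := by rw [smul_mul', smul_inv_smul])


/-- `X` is `A`-quasisimple: it is generated by its components, the set of components
is nonempty, and `A` permutes the components transitively. -/
def IsAQuasisimple (A X : Type) [Group A] [Group X] [MulDistribMulAction A X] : Prop :=
  {K : Subgroup X | IsComponent K}.Nonempty ∧
  sSup {K : Subgroup X | IsComponent K} = ⊤ ∧
  ∀ K L : Subgroup X, IsComponent K → IsComponent L → ∃ a : A, a • K = L

/-- An `A`-component: the subgroup generated by an orbit of `A` on the components. -/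
def IsAComponent (A : Type) {G : Type} [Group A] [Group G] [MulDistribMulAction A G]
    (K : Subgroup G) : Prop :=
  ∃ L : Subgroup G, IsComponent L ∧ K = ⨆ a : A, a • L

/-- An `(A,𝒫)`-component: an `A`-invariant subnormal subgroup `K` with
`K = O^𝒫(K)` and `K/O_𝒫(K)` `A`-quasisimple under the induced action. -/
def IsAPComponent (P : (X : Type) → [inst : Group X] → Prop) (A : Type) {G : Type}
    [Group A] [Group G] [MulDistribMulAction A G] (K : Subgroup G) : Prop :=
  IsSubnormal K ∧ Oup P ↥K = ⊤ ∧
  ∃ hK : ∀ (a : A) (x : G), x ∈ K → a • x ∈ K,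
    letI := invSubAction A K hK
    ∃ hOp : ∀ (a : A) (x : ↥K), x ∈ Op P ↥K → a • x ∈ Op P ↥K,
      letI := invQuotAction A (Op P ↥K) hOp
      IsAQuasisimple A (↥K ⧸ Op P ↥K)

/-- The commutator `[X, t]` of a subgroup with an element acting on `G`;
the subgroup generated by all `x⁻¹ * (t • x)`, `x ∈ X`. -/
def commSub {A : Type} {G : Type} [Monoid A] [Group G] [MulDistribMulAction A G]
    (t : A) (X : Subgroup G) : Subgroup G :=
  Subgroup.closure {y : G | ∃ x ∈ X, y = x⁻¹ * (t • x)}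


/-- `O_{n𝒫}(G)`: the subgroup generated by all `A`-invariant normal subgroups whose
fixed-point subgroup under `A` is a `𝒫`-group. -/
def OnP (P : (X : Type) → [inst : Group X] → Prop) (A : Type) (G : Type) [Monoid A] [Group G]
    [MulDistribMulAction A G] : Subgroup G :=
  genBy {N : Subgroup G | N.Normal ∧ (∀ (a : A) (x : G), x ∈ N → a • x ∈ N) ∧
    P ↥(N ⊓ FixedPoints.subgroup A G)}

/-- The group-theoretic property "is solvable". -/
def solP : (X : Type) → [inst : Group X] → Prop := fun X _ => IsSolvable X

/-- `K` is a normal subgroup of `H`, both being subgroups of a common group. -/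
def NormalIn {G : Type} [Group G] (K H : Subgroup G) : Prop :=
  K ≤ H ∧ H ≤ Subgroup.normalizer (K : Set G)

/-- `K` is a subnormal subgroup of `H`, both being subgroups of a common group. -/
def SubnormalIn {G : Type} [Group G] : Subgroup G → Subgroup G → Prop :=
  Relation.ReflTransGen NormalIn

/-- A perfect subgroup each of whose proper normal subgroups is central. -/
def IsPerfectCentral {G : Type} [Group G] (L : Subgroup G) : Prop :=
  ⁅L, L⁆ = L ∧ ∀ N, NormalIn N L → N = L ∨ ⁅N, L⁆ = ⊥

section Subnormal

variable {G H : Type} [Group G] [Group H]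

theorem NormalIn.map (f : G →* H) {K L : Subgroup G} (h : NormalIn K L) :
    NormalIn (K.map f) (L.map f) :=
  ⟨Subgroup.map_mono h.1, (Subgroup.map_mono h.2).trans (Subgroup.le_normalizer_map f)⟩

theorem NormalIn.comap (f : G →* H) {K L : Subgroup H} (h : NormalIn K L) :
    NormalIn (K.comap f) (L.comap f) :=
  ⟨Subgroup.comap_mono h.1, (Subgroup.comap_mono h.2).trans (Subgroup.le_normalizer_comap f)⟩

theorem NormalIn.inf_right {K L : Subgroup G} (h : NormalIn K L) (M : Subgroup G) :
    NormalIn (K ⊓ M) (L ⊓ M) :=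
  ⟨inf_le_inf_right M h.1, (inf_le_inf h.2 Subgroup.le_normalizer).trans
    Subgroup.inf_normalizer_le_normalizer_inf⟩

theorem SubnormalIn.le {K L : Subgroup G} (h : SubnormalIn K L) : K ≤ L := by
  induction h with
  | refl => exact le_rfl
  | tail _ h ih => exact ih.trans h.1

theorem SubnormalIn.map (f : G →* H) {K L : Subgroup G} (h : SubnormalIn K L) :
    SubnormalIn (K.map f) (L.map f) :=
  Relation.ReflTransGen.lift (Subgroup.map f) (fun _ _ => NormalIn.map f) _ _ h

theorem SubnormalIn.inf_right {K L : Subgroup G} (h : SubnormalIn K L) (M : Subgroup G) :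
    SubnormalIn (K ⊓ M) (L ⊓ M) :=
  Relation.ReflTransGen.lift (· ⊓ M) (fun _ _ h => NormalIn.inf_right h M) _ _ h

theorem IsSubnormal.subnormalIn_top {K : Subgroup G} (h : IsSubnormal K) : SubnormalIn K ⊤ := by
  obtain ⟨n, c, rfl, hlast, hstep⟩ := h
  rw [← hlast]
  have key : ∀ i : Fin (n + 1), SubnormalIn (c 0) (c i) := by
    intro i
    induction i using Fin.induction with
    | zero => exact .refl
    | succ i ih =>
      exact ih.tail ⟨(hstep i).1,
        (Subgroup.normal_subgroupOf_iff_le_normalizer (hstep i).1).1 (hstep i).2⟩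
  exact key _

theorem SubnormalIn.eq_or_exists_lt {K L : Subgroup G} (h : SubnormalIn K L) :
    K = L ∨ ∃ N, SubnormalIn K N ∧ NormalIn N L ∧ N < L := by
  induction h with
  | refl => exact .inl rfl
  | @tail B C hB hC ih =>
    rcases hC.1.eq_or_lt with rfl | hlt
    · exact ih
    · exact .inr ⟨B, hB, hC, hlt⟩

/-- If conjugation by `W` maps each member of `S` into `sSup S`, then `W` normalizes `sSup S`. -/
theorem le_normalizer_sSup {S : Set (Subgroup G)} {W : Subgroup G}
    (h : ∀ w ∈ W, ∀ M ∈ S, M.map (MulAut.conj w : G →* G) ≤ sSup S) :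
    W ≤ Subgroup.normalizer ((sSup S : Subgroup G) : Set G) := by
  rw [Subgroup.le_normalizer_iff]
  intro w hw k hk
  have : sSup S ≤ (sSup S).comap (MulAut.conj w : G →* G) :=
    sSup_le fun M hM => Subgroup.map_le_iff_le_comap.1 (h w hw M hM)
  simpa using this hk

theorem map_conj_eq_of_le_normalizer {W K : Subgroup G}
    (h : W ≤ Subgroup.normalizer (K : Set G)) {w : G} (hw : w ∈ W) :
    K.map (MulAut.conj w : G →* G) = K :=
  Subgroup.mem_normalizer_iff_map_conj_eq.1 (h hw)

theorem IsPerfectCentral.map (f : G →* H) {L : Subgroup G} (hL : IsPerfectCentral L) :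
    IsPerfectCentral (L.map f) := by
  refine ⟨by rw [← Subgroup.map_commutator, hL.1], fun N hN => ?_⟩
  have hmap : (N.comap f ⊓ L).map f = N := by
    refine le_antisymm (Subgroup.map_le_iff_le_comap.2 inf_le_left) fun x hx => ?_
    obtain ⟨y, hy, rfl⟩ := hN.1 hx
    exact ⟨y, ⟨hx, hy⟩, rfl⟩
  have hnorm : NormalIn (N.comap f ⊓ L) L := by
    have := (hN.comap f).inf_right L
    rwa [inf_eq_right.2 (Subgroup.le_comap_map f L)] at this
  rcases hL.2 _ hnorm with h | h
  · left; rw [← hmap, h]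
  · right; rw [← hmap, ← Subgroup.map_commutator, h, Subgroup.map_bot]

theorem IsQuasisimple.isPerfectCentral {L : Subgroup G} (h : IsQuasisimple L) :
    IsPerfectCentral L := by
  obtain ⟨hperf, hsimple, -⟩ := h
  have hLL : ⁅L, L⁆ = L := by
    rw [← Subgroup.map_subtype_commutator, hperf, ← MonoidHom.range_eq_map, Subgroup.range_subtype]
  refine ⟨hLL, fun N hN => ?_⟩
  have hNn : (N.subgroupOf L).Normal :=
    (Subgroup.normal_subgroupOf_iff_le_normalizer hN.1).2 hN.2
  have hmn : ((N.subgroupOf L).map (QuotientGroup.mk' (Subgroup.center L))).Normal :=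
    hNn.map _ (QuotientGroup.mk'_surjective _)
  rcases hmn.eq_bot_or_eq_top with h | h
  · right
    rw [Subgroup.map_eq_bot_iff, QuotientGroup.ker_mk'] at h
    rw [Subgroup.commutator_eq_bot_iff_le_centralizer]
    intro x hx
    rw [Subgroup.mem_centralizer_iff]
    intro y hy
    have := Subgroup.mem_center_iff.1
      (h (show (⟨x, hN.1 hx⟩ : L) ∈ N.subgroupOf L from hx)) ⟨y, hy⟩
    exact congrArg Subtype.val this
  · left
    refine le_antisymm hN.1 ?_
    rw [← Subgroup.subgroupOf_eq_top, eq_top_iff, ← hperf, commutator_def,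
      Subgroup.commutator_le]
    have hdec : ∀ g : L, ∃ n ∈ N.subgroupOf L, ∃ z ∈ Subgroup.center L, g = n * z := by
      intro g
      obtain ⟨n, hn, hng⟩ := h.ge (Subgroup.mem_top (QuotientGroup.mk' (Subgroup.center L) g))
      exact ⟨n, hn, n⁻¹ * g, QuotientGroup.eq.1 hng, by group⟩
    intro a _ b _
    obtain ⟨n, hn, z, hz, rfl⟩ := hdec a
    obtain ⟨m, hm, w, hw, rfl⟩ := hdec b
    have hzc := Subgroup.mem_center_iff.1 hz
    have hwc := Subgroup.mem_center_iff.1 hw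
    have : n * z * (m * w) * (n * z)⁻¹ * (m * w)⁻¹ = n * m * n⁻¹ * m⁻¹ := by
      have h1 : n * z * (m * w) * (n * z)⁻¹ * (m * w)⁻¹ =
          n * (z * (m * w)) * z⁻¹ * n⁻¹ * w⁻¹ * m⁻¹ := by group
      have h2 : n * (m * w * z) * z⁻¹ * n⁻¹ * w⁻¹ * m⁻¹ = n * m * (w * n⁻¹) * w⁻¹ * m⁻¹ := by
        group
      rw [h1, ← hzc, h2, ← hwc]; group
    rw [commutatorElement_def, this]
    exact mul_mem (mul_mem (mul_mem hn hm) (inv_mem hn)) (inv_mem hm)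

/-- A quasisimple subnormal subgroup lies in or commutes with any other subnormal subgroup. -/
theorem IsPerfectCentral.le_or_commutator_eq_bot [Finite G] (W : Subgroup G) :
    ∀ L M : Subgroup G, IsPerfectCentral L → SubnormalIn L W → SubnormalIn M W →
      L ≤ M ∨ ⁅L, M⁆ = ⊥ := by
  induction W using WellFoundedLT.induction with
  | ind W ih =>
    intro L M hL hLW hMW
    rcases hMW.eq_or_exists_lt with rfl | ⟨B, hMB, hBW, hBlt⟩
    · exact .inl hLW.le
    rcases hLW.eq_or_exists_lt with rfl | ⟨A, hLA, hAW, hAlt⟩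
    · right
      rcases hL.2 B hBW with h | h
      · exact absurd h hBlt.ne
      · rw [Subgroup.commutator_comm, eq_bot_iff, ← h]
        exact Subgroup.commutator_mono hMB.le le_rfl
    by_cases hLB : L ≤ B
    · refine ih B hBlt L M hL ?_ hMB
      have := hLW.inf_right B
      rwa [inf_eq_left.2 hLB, inf_eq_right.2 hBW.1] at this
    · have hD : NormalIn (A ⊓ B) A := by
        have := hBW.inf_right A
        rwa [inf_eq_right.2 hAW.1, inf_comm] at this
      rcases ih A hAlt L (A ⊓ B) hL hLA (.single hD) with h | h
      · exact absurd (h.trans inf_le_right) hLB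
      right
      have hle : ⁅L, M⁆ ≤ A ⊓ B := by
        refine (Subgroup.commutator_mono hLA.le hMB.le).trans (le_inf ?_ ?_)
        · exact Subgroup.le_normalizer_iff_commutator_le_left.1 (hBW.1.trans hAW.2)
        · exact Subgroup.le_normalizer_iff_commutator_le_right.1 (hAW.1.trans hBW.2)
      have h1 : ⁅⁅L, M⁆, L⁆ = ⊥ := by
        rw [Subgroup.commutator_comm, eq_bot_iff, ← h]
        exact Subgroup.commutator_mono le_rfl hle
      have h2 : ⁅⁅M, L⁆, L⁆ = ⊥ := by rwa [Subgroup.commutator_comm M L]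
      have := Subgroup.commutator_commutator_eq_bot_of_rotate h1 h2
      rwa [hL.1] at this

theorem IsPerfectCentral.le_normalizer [Finite G] {L M : Subgroup G}
    (hL : IsPerfectCentral L) (hM : IsPerfectCentral M)
    (hLs : SubnormalIn L ⊤) (hMs : SubnormalIn M ⊤) :
    L ≤ Subgroup.normalizer (M : Set G) := by
  have comm : ⁅L, M⁆ = ⊥ → L ≤ Subgroup.normalizer (M : Set G) := fun h =>
    Subgroup.le_normalizer_iff_commutator_le_right.2 (h ▸ bot_le)
  rcases hL.le_or_commutator_eq_bot ⊤ L M hLs hMs with h | h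
  · exact h.trans Subgroup.le_normalizer
  · exact comm h

/-- The subgroup generated by the subnormal subgroups that are perfect with all proper normal
subgroups central. -/
def layer (G : Type) [Group G] : Subgroup G :=
  sSup {L | IsPerfectCentral L ∧ SubnormalIn L ⊤}

instance layer_normal : (layer G).Normal := by
  rw [← Subgroup.normalizer_eq_top_iff, eq_top_iff]
  refine le_normalizer_sSup fun g _ M hM => le_sSup ⟨hM.1.map _, ?_⟩
  have := hM.2.map (MulAut.conj g : G →* G)
  rwa [Subgroup.map_top_of_surjective _ (MulAut.conj g).surjective] at this

theorem layer_le_normalizer_sSup [Finite G] {S : Set (Subgroup G)}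
    (hS : ∀ L ∈ S, IsPerfectCentral L ∧ SubnormalIn L ⊤) :
    layer G ≤ Subgroup.normalizer ((sSup S : Subgroup G) : Set G) :=
  sSup_le fun L hL => le_normalizer_sSup fun w hw M hM => by
    rw [map_conj_eq_of_le_normalizer (hL.1.le_normalizer (hS M hM).1 hL.2 (hS M hM).2) hw]
    exact le_sSup hM

end Subnormal

section Property

/-- `𝒫` is invariant under isomorphism of finite groups. -/
abbrev IsoClosed (P : (X : Type) → [inst : Group X] → Prop) : Prop :=
  ∀ (X Y : Type) [Group X] [Group Y] [Finite X], Nonempty (X ≃* Y) → P X → P Y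

/-- Subgroups of finite `𝒫`-groups are `𝒫`-groups. -/
abbrev SubgroupClosed (P : (X : Type) → [inst : Group X] → Prop) : Prop :=
  ∀ (X : Type) [Group X] [Finite X], P X → ∀ H : Subgroup X, P ↥H

/-- Quotients of finite `𝒫`-groups are `𝒫`-groups. -/
abbrev QuotientClosed (P : (X : Type) → [inst : Group X] → Prop) : Prop :=
  ∀ (X : Type) [Group X] [Finite X], P X → ∀ (N : Subgroup X) [N.Normal], P (X ⧸ N)

/-- The join of two normal `𝒫`-subgroups of a finite group is a `𝒫`-group. -/
abbrev JoinClosed (P : (X : Type) → [inst : Group X] → Prop) : Prop :=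
  ∀ (X : Type) [Group X] [Finite X] (M N : Subgroup X) [M.Normal] [N.Normal],
    P ↥M → P ↥N → P ↥(M ⊔ N)

variable {P : (X : Type) → [inst : Group X] → Prop} {G : Type} [Group G]

/-- The subgroup generated by the `𝒫`-subgroups that are normal in `W`. -/
def radIn (P : (X : Type) → [inst : Group X] → Prop) (W : Subgroup G) : Subgroup G :=
  sSup {M | NormalIn M W ∧ P M}

theorem radIn_le (W : Subgroup G) : radIn P W ≤ W :=
  sSup_le fun _ hM => hM.1.1

variable [Finite G]

theorem le_normalizer_radIn (hIso : IsoClosed P)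
    {V W : Subgroup G} (h : NormalIn V W) :
    W ≤ Subgroup.normalizer (radIn P V : Set G) := by
  refine le_normalizer_sSup fun w hw M hM => le_sSup ⟨?_, ?_⟩
  · have := hM.1.map (MulAut.conj w : G →* G)
    rwa [map_conj_eq_of_le_normalizer h.2 hw] at this
  · exact hIso _ _ ⟨M.equivMapOfInjective _ (MulAut.conj w).injective⟩ hM.2

theorem map_Op_le_radIn (hIso : IsoClosed P)
    (K : Subgroup G) : (Op P K).map K.subtype ≤ radIn P K := by
  rw [Subgroup.map_le_iff_le_comap, Op, genBy, Subgroup.closure_le]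
  refine Set.iUnion₂_subset fun N hN => ?_
  change N ≤ _
  rw [← Subgroup.map_le_iff_le_comap]
  refine le_sSup ⟨⟨Subgroup.map_subtype_le N, ?_⟩, ?_⟩
  · have := Subgroup.le_normalizer_map (H := N) K.subtype
    rwa [Subgroup.normalizer_eq_top_iff.2 hN.1, ← MonoidHom.range_eq_map,
      Subgroup.range_subtype] at this
  · exact hIso _ _ ⟨N.equivMapOfInjective _ K.subtype_injective⟩ hN.2

theorem Oup_eq_top_of_equiv (hIso : IsoClosed P)
    {X Y : Type} [Group X] [Group Y] [Finite Y] (e : X ≃* Y)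
    (h : Oup P X = ⊤) : Oup P Y = ⊤ := by
  refine eq_top_iff.2 (le_iInf₂ fun N hN => ?_)
  obtain ⟨hNn, hP⟩ := hN
  let f : X →* Y ⧸ N := (QuotientGroup.mk' N).comp e.toMonoidHom
  have hf : Function.Surjective f := (QuotientGroup.mk'_surjective N).comp e.surjective
  have hker : Oup P X ≤ f.ker := iInf₂_le f.ker
    ⟨inferInstance, hIso _ _ ⟨(QuotientGroup.quotientKerEquivOfSurjective f hf).symm⟩ hP⟩
  intro y _
  have : e.symm y ∈ f.ker := hker (h ▸ Subgroup.mem_top _)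
  simpa [f, MonoidHom.mem_ker] using this

theorem normalIn_sup_of_property (hIso : IsoClosed P) (hJoin : JoinClosed P)
    {M N W : Subgroup G} (hM : NormalIn M W ∧ P M)
    (hN : NormalIn N W ∧ P N) : NormalIn (M ⊔ N) W ∧ P ↥(M ⊔ N) := by
  have hle : M ⊔ N ≤ W := sup_le hM.1.1 hN.1.1
  refine ⟨⟨hle, fun w hw => ?_⟩, ?_⟩
  · rw [Subgroup.mem_normalizer_iff_map_conj_eq, Subgroup.map_sup,
      map_conj_eq_of_le_normalizer hM.1.2 hw, map_conj_eq_of_le_normalizer hN.1.2 hw]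
  · have := (Subgroup.normal_subgroupOf_iff_le_normalizer hM.1.1).2 hM.1.2
    have := (Subgroup.normal_subgroupOf_iff_le_normalizer hN.1.1).2 hN.1.2
    have := hJoin W (M.subgroupOf W) (N.subgroupOf W)
      (hIso _ _ ⟨(Subgroup.subgroupOfEquivOfLe hM.1.1).symm⟩ hM.2)
      (hIso _ _ ⟨(Subgroup.subgroupOfEquivOfLe hN.1.1).symm⟩ hN.2)
    rw [← Subgroup.subgroupOf_sup hM.1.1 hN.1.1] at this
    exact hIso _ _ ⟨Subgroup.subgroupOfEquivOfLe hle⟩ this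

theorem radIn_eq_bot_or (hIso : IsoClosed P) (hJoin : JoinClosed P)
    (W : Subgroup G) :
    radIn P W = ⊥ ∨ (NormalIn (radIn P W) W ∧ P ↥(radIn P W)) := by
  refine Set.Finite.induction_on_subset
    (motive := fun S _ => sSup S = ⊥ ∨ (NormalIn (sSup S) W ∧ P ↥(sSup S)))
    _ (Set.toFinite {M | NormalIn M W ∧ P M}) (.inl sSup_empty) ?_
  intro M S hM _ _ ih
  right
  rw [sSup_insert]
  rcases ih with h | h
  · rwa [h, sup_bot_eq]
  · exact normalIn_sup_of_property hIso hJoin hM h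

theorem SubnormalIn.radIn_le (hIso : IsoClosed P) (hJoin : JoinClosed P)
    {V W : Subgroup G} (h : SubnormalIn V W) :
    radIn P V ≤ radIn P W := by
  induction h with
  | refl => exact le_rfl
  | @tail B C _ hBC ih =>
    refine ih.trans ?_
    rcases radIn_eq_bot_or hIso hJoin B with h | h
    · exact h ▸ bot_le
    · exact le_sSup ⟨⟨(PaperPF.radIn_le B).trans hBC.1, le_normalizer_radIn hIso hBC⟩, h.2⟩

theorem le_of_Oup_eq_top (hIso : IsoClosed P) (hSub : SubgroupClosed P)
    {K N W : Subgroup G} (hK : Oup P K = ⊤) (hKW : K ≤ W)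
    [(N.subgroupOf W).Normal] (hP : P (W ⧸ N.subgroupOf W)) : K ≤ N := by
  let f : K →* W ⧸ N.subgroupOf W :=
    (QuotientGroup.mk' (N.subgroupOf W)).comp (Subgroup.inclusion hKW)
  have hker : Oup P K ≤ f.ker := iInf₂_le f.ker
    ⟨inferInstance, hIso _ _ ⟨(QuotientGroup.quotientKerEquivRange f).symm⟩ (hSub _ hP f.range)⟩
  intro k hk
  have : (⟨k, hk⟩ : K) ∈ f.ker := hker (hK ▸ Subgroup.mem_top _)
  have h2 : Subgroup.inclusion hKW ⟨k, hk⟩ ∈ N.subgroupOf W :=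
    (QuotientGroup.eq_one_iff _).1 (MonoidHom.mem_ker.1 this)
  exact h2

theorem property_quotient_of_le_sup
    (hIso : IsoClosed P) (hSub : SubgroupClosed P) (hQuot : QuotientClosed P)
    {K W Q : Subgroup G} [Q.Normal] (hQ : P Q) (hKW : K ≤ W)
    (hW : W ≤ K ⊔ Q) [(K.subgroupOf W).Normal] : P (W ⧸ K.subgroupOf W) := by
  let f : ↥(W ⊓ Q) →* W ⧸ K.subgroupOf W :=
    (QuotientGroup.mk' (K.subgroupOf W)).comp (Subgroup.inclusion inf_le_left)
  have hf : Function.Surjective f := by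
    intro x
    obtain ⟨w, rfl⟩ := QuotientGroup.mk'_surjective _ x
    obtain ⟨k, hk, q, hq, hkq⟩ := Subgroup.mem_sup_of_normal_right.1 (hW w.2)
    have hqW : q ∈ W := by
      rw [← inv_mul_cancel_left k q, hkq]
      exact mul_mem (inv_mem (hKW hk)) w.2
    refine ⟨⟨q, hqW, hq⟩, ?_⟩
    have hw : w = ⟨k, hKW hk⟩ * ⟨q, hqW⟩ := Subtype.ext hkq.symm
    have h1 : QuotientGroup.mk' (K.subgroupOf W) ⟨k, hKW hk⟩ = 1 :=
      (QuotientGroup.eq_one_iff _).2 hk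
    rw [hw, map_mul, h1, one_mul]
    rfl
  have hWQ : P ↥(W ⊓ Q) :=
    hIso _ _ ⟨Subgroup.subgroupOfEquivOfLe inf_le_right⟩ (hSub _ hQ ((W ⊓ Q).subgroupOf Q))
  exact hIso _ _ ⟨QuotientGroup.quotientKerEquivOfSurjective f hf⟩ (hQuot _ hWQ f.ker)

/-- If `K` is subnormal in `W ≤ KQ` with `Q` a normal `𝒫`-subgroup, and `K = O^𝒫(K)`, then `K`
contains every subgroup `L = O^𝒫(L)` of `W`. -/
theorem SubnormalIn.le_of_Oup_eq_top
    (hIso : IsoClosed P) (hSub : SubgroupClosed P) (hQuot : QuotientClosed P)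
    {K W Q : Subgroup G} [Q.Normal] (hQ : P Q)
    (hK : Oup P K = ⊤) (h : SubnormalIn K W) (hW : W ≤ K ⊔ Q) :
    ∀ L ≤ W, Oup P L = ⊤ → L ≤ K := by
  induction h with
  | refl => exact fun L hL _ => hL
  | @tail B C hKB hBC ih =>
    have ihB := ih (hBC.1.trans hW)
    have hKC : K ≤ C := (SubnormalIn.le hKB).trans hBC.1
    have hnorm : C ≤ Subgroup.normalizer (K : Set G) := by
      rw [Subgroup.le_normalizer_iff]
      intro c hc k hk
      refine ihB (K.map (MulAut.conj c : G →* G)) ?_ ?_ ⟨k, hk, by simp⟩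
      · rw [← map_conj_eq_of_le_normalizer hBC.2 hc]
        exact Subgroup.map_mono (SubnormalIn.le hKB)
      · exact Oup_eq_top_of_equiv hIso (K.equivMapOfInjective _ (MulAut.conj c).injective) hK
    have := (Subgroup.normal_subgroupOf_iff_le_normalizer hKC).2 hnorm
    exact fun L hL hLO => PaperPF.le_of_Oup_eq_top hIso hSub hLO hL
      (property_quotient_of_le_sup hIso hSub hQuot hQ hKC hW)

end Property

theorem statement_11
    (P : (X : Type) → [inst : Group X] → Prop)
    (hIso : ∀ (X Y : Type) [Group X] [Group Y] [Finite X], Nonempty (X ≃* Y) → P X → P Y)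
    (hSubClosed : ∀ (X : Type) [Group X] [Finite X], P X → ∀ H : Subgroup X, P ↥H)
    (hQuotClosed : ∀ (X : Type) [Group X] [Finite X], P X → ∀ (N : Subgroup X) [N.Normal], P (X ⧸ N))
    (hInfClosed : ∀ (X : Type) [Group X] [Finite X] (M N : Subgroup X) [M.Normal] [N.Normal],
      P (X ⧸ M) → P (X ⧸ N) → P (X ⧸ (M ⊓ N)))
    (hJoinClosed : ∀ (X : Type) [Group X] [Finite X] (M N : Subgroup X) [M.Normal] [N.Normal],
      P ↥M → P ↥N → P ↥(M ⊔ N))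
    (A G : Type) [Group A] [Group G] [Finite A] [Finite G]
    [MulDistribMulAction A G]
    (K : Subgroup G) (hK : IsAPComponent P A K) :
    (K.subgroupOf (Subgroup.normalClosure (K : Set G))).Normal := by
  obtain ⟨hsub, hO, hKA, hOpA, hne, hgen, -⟩ := hK
  have hKs : SubnormalIn K ⊤ := hsub.subnormalIn_top
  set Q : Subgroup G := radIn P ⊤ with hQdef
  have hQn : Q.Normal := by
    rw [← Subgroup.normalizer_eq_top_iff, eq_top_iff]
    exact le_normalizer_radIn hIso ⟨le_rfl, Subgroup.le_normalizer⟩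
  have hKQ : SubnormalIn K (K ⊔ Q) := by
    have := hKs.inf_right (K ⊔ Q)
    rwa [inf_eq_left.2 le_sup_left, top_inf_eq] at this
  have hmax : ∀ L ≤ K ⊔ Q, Oup P L = ⊤ → L ≤ K := by
    rcases radIn_eq_bot_or hIso hJoinClosed (⊤ : Subgroup G) with h | h
    · intro L hL _
      rwa [hQdef, h, sup_bot_eq] at hL
    · exact SubnormalIn.le_of_Oup_eq_top hIso hSubClosed hQuotClosed h.2 hO hKQ le_rfl
  have hOpQ : Op P K ≤ Q.comap K.subtype := by
    rw [← Subgroup.map_le_iff_le_comap]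
    exact (map_Op_le_radIn hIso K).trans (hKs.radIn_le hIso hJoinClosed)
  let f : (K ⧸ Op P K) →* G ⧸ Q := QuotientGroup.map (Op P K) Q K.subtype hOpQ
  have hfrange : f.range = K.map (QuotientGroup.mk' Q) := by
    ext x
    constructor
    · rintro ⟨y, rfl⟩
      obtain ⟨k, rfl⟩ := QuotientGroup.mk'_surjective _ y
      exact ⟨k, k.2, rfl⟩
    · rintro ⟨k, hk, rfl⟩
      exact ⟨QuotientGroup.mk' _ ⟨k, hk⟩, rfl⟩
  have hbar : SubnormalIn (K.map (QuotientGroup.mk' Q)) ⊤ := by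
    have := hKs.map (QuotientGroup.mk' Q)
    rwa [Subgroup.map_top_of_surjective _ (QuotientGroup.mk'_surjective Q)] at this
  let S : Set (Subgroup (G ⧸ Q)) := Subgroup.map f '' {C | IsComponent C}
  have hS : ∀ L ∈ S, IsPerfectCentral L ∧ SubnormalIn L ⊤ := by
    rintro _ ⟨C, hC, rfl⟩
    refine ⟨hC.2.isPerfectCentral.map f, ?_⟩
    have := hC.1.subnormalIn_top.map f
    rw [← MonoidHom.range_eq_map, hfrange] at this
    exact this.trans hbar
  have hSK : sSup S = K.map (QuotientGroup.mk' Q) := by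
    rw [← hfrange, MonoidHom.range_eq_map, ← hgen, (Subgroup.gc_map_comap f).l_sSup, sSup_image]
  have hlayer : (layer (G ⧸ Q)).comap (QuotientGroup.mk' Q) ≤
      Subgroup.normalizer ((K ⊔ Q : Subgroup G) : Set G) := by
    have h1 := layer_le_normalizer_sSup hS
    have h2 : (K.map (QuotientGroup.mk' Q)).comap (QuotientGroup.mk' Q) = K ⊔ Q := by
      rw [Subgroup.comap_map_eq, QuotientGroup.ker_mk']
    rw [hSK] at h1
    rw [← h2]
    exact (Subgroup.comap_mono h1).trans
      (Subgroup.le_normalizer_comap (H := K.map (QuotientGroup.mk' Q)) (QuotientGroup.mk' Q))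
  have hKlayer : K ≤ (layer (G ⧸ Q)).comap (QuotientGroup.mk' Q) := by
    rw [← Subgroup.map_le_iff_le_comap, ← hSK]
    exact sSup_le_sSup hS
  have hcl : Subgroup.normalClosure (K : Set G) ≤
      Subgroup.normalizer ((K ⊔ Q : Subgroup G) : Set G) :=
    (Subgroup.normalClosure_le_normal hKlayer).trans hlayer
  rw [Subgroup.normal_subgroupOf_iff_le_normalizer Subgroup.subset_normalClosure,
    Subgroup.le_normalizer_iff]
  intro g hg k hk
  refine hmax (K.map (MulAut.conj g : G →* G)) ?_ ?_ ⟨k, hk, by simp⟩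
  · rw [← map_conj_eq_of_le_normalizer hcl hg]
    exact Subgroup.map_mono le_sup_left
  · exact Oup_eq_top_of_equiv hIso (K.equivMapOfInjective _ (MulAut.conj g).injective) hO

end PaperPF
end

section
/- Let G be a finite group and H, M subgroups of G with O_{𝒫,E}(H) ≤ M and O_{𝒫,E}(M) ≤ H. Then O_{𝒫,E}(H) = O_{𝒫,E}(M). -/
open Pointwise

namespace PaperPF
set_option linter.unusedVariables false

/-- The closure hypotheses on a property of finite groups: invariance under isomorphism, closure
under subgroups, quotients and extensions, and validity for all solvable groups. -/
structure IsSolvableClosedClass (P : (X : Type) → [inst : Group X] → Prop) : Prop where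
  iso : ∀ (X Y : Type) [Group X] [Group Y] [Finite X], Nonempty (X ≃* Y) → P X → P Y
  sub : ∀ (X : Type) [Group X] [Finite X], P X → ∀ H : Subgroup X, P ↥H
  quot : ∀ (X : Type) [Group X] [Finite X], P X → ∀ (N : Subgroup X) [N.Normal], P (X ⧸ N)
  ext : ∀ (X : Type) [Group X] [Finite X] (N : Subgroup X) [N.Normal],
      P ↥N → P (X ⧸ N) → P X
  solv : ∀ (X : Type) [Group X] [Finite X], Group.IsSolvable X → P X

/-- A group that is not a `𝒫`-group although all its proper normal subgroups are. -/
def IsMinimalNonP (P : (X : Type) → [inst : Group X] → Prop) (X : Type) [Group X] : Prop :=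
  ¬ P X ∧ ∀ N : Subgroup X, N.Normal → N ≠ ⊤ → P ↥N

theorem isSubnormal_iff_subgroup_isSubnormal {X : Type} [Group X] {K : Subgroup X} :
    IsSubnormal K ↔ K.IsSubnormal := by
  constructor
  · rintro ⟨n, c, rfl, hn, hc⟩
    have key : ∀ i : Fin (n + 1), (c i).IsSubnormal := by
      intro i
      induction i using Fin.reverseInduction with
      | last => rw [hn]; exact .top
      | cast i ih => exact .step _ _ (hc i).1 ih (hc i).2
    exact key 0
  · intro h
    obtain ⟨n, f, hf, hfn, h0, hn⟩ := Subgroup.IsSubnormal.isSubnormal_iff.1 h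
    exact ⟨n, fun i => f i, h0, hn, fun i => ⟨hf (Nat.le_succ i), hfn i⟩⟩

theorem genBy_eq_sSup {X : Type} [Group X] (S : Set (Subgroup X)) : genBy S = sSup S := by
  rw [genBy, Subgroup.closure_iUnion, sSup_eq_iSup]
  simp only [Subgroup.closure_iUnion, Subgroup.closure_eq]

theorem isSubnormal_comap {X Y : Type} [Group X] [Group Y] (f : X →* Y) {K : Subgroup Y}
    (hK : K.IsSubnormal) : (K.comap f).IsSubnormal := by
  induction hK with
  | top => rw [Subgroup.comap_top]; exact .top
  | step H K hle _ hN ih =>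
    refine .step _ _ (Subgroup.comap_mono hle) ih ⟨?_⟩
    rintro ⟨x, hxK⟩ hx ⟨y, hy⟩
    have := hN.conj_mem ⟨f x, hxK⟩ hx ⟨f y, hy⟩
    simpa [Subgroup.mem_subgroupOf] using this

theorem commutator_commutator_le_of_le {X : Type} [Group X] {K N R : Subgroup X} [R.Normal]
    (h : ⁅K, ⁅K, N⁆⁆ ≤ R) : ⁅⁅K, K⁆, N⁆ ≤ R := by
  have aux : ∀ A : Subgroup X, A ≤ R ↔ A.map (QuotientGroup.mk' R) = ⊥ := by
    intro A
    rw [Subgroup.map_eq_bot_iff, QuotientGroup.ker_mk']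
  rw [aux] at h ⊢
  simp only [Subgroup.map_commutator] at h ⊢
  rw [Subgroup.commutator_comm] at h
  apply Subgroup.commutator_commutator_eq_bot_of_rotate
  · exact h
  · rwa [Subgroup.commutator_comm (Subgroup.map _ N)]

theorem commutator_le_of_left_le_normal {X : Type} [Group X] {A B R : Subgroup X} [hR : R.Normal]
    (h : A ≤ R) : ⁅A, B⁆ ≤ R :=
  (Subgroup.commutator_mono h le_rfl).trans
    ((Subgroup.commutator_mono le_rfl le_top).trans (Subgroup.commutator_top_right_le_iff.2 hR))

section

variable {P : (X : Type) → [inst : Group X] → Prop}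

theorem le_Op {X : Type} [Group X] {N : Subgroup X} (hN : N.Normal) (h : P ↥N) : N ≤ Op P X := by
  rw [Op, genBy_eq_sSup]
  exact le_sSup ⟨hN, h⟩

namespace IsSolvableClosedClass

variable (hP : IsSolvableClosedClass P)

include hP

theorem of_surjective {X Y : Type} [Group X] [Group Y] [Finite X] (f : X →* Y)
    (hf : Function.Surjective f) (h : P X) : P Y :=
  hP.iso _ _ ⟨QuotientGroup.quotientKerEquivOfSurjective f hf⟩ (hP.quot X h f.ker)

theorem of_injective {X Y : Type} [Group X] [Group Y] [Finite Y] (f : X →* Y)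
    (hf : Function.Injective f) (h : P Y) : P X :=
  hP.iso _ _ ⟨(MonoidHom.ofInjective hf).symm⟩ (hP.sub Y h f.range)

theorem mono {X : Type} [Group X] [Finite X] {A B : Subgroup X} (h : A ≤ B) (hB : P ↥B) : P ↥A :=
  hP.of_injective (Subgroup.inclusion h) (Subgroup.inclusion_injective h) hB

theorem map {X Y : Type} [Group X] [Group Y] [Finite X] (f : X →* Y) {A : Subgroup X}
    (h : P ↥A) : P ↥(A.map f) :=
  hP.of_surjective (f.subgroupMap A) (f.subgroupMap_surjective A) h

theorem comap {X Y : Type} [Group X] [Group Y] [Finite Y] (f : X →* Y)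
    (hf : Function.Injective f) {A : Subgroup Y} (h : P ↥A) : P ↥(A.comap f) :=
  hP.of_injective (f.subgroupComap A)
    (fun _ _ hab => Subtype.ext (hf (congrArg Subtype.val hab))) h

theorem of_ker_range {X Y : Type} [Group X] [Group Y] [Finite X] (f : X →* Y)
    (hker : P ↥f.ker) (hrange : P ↥f.range) : P X :=
  have : Finite f.range := Finite.of_surjective _ f.rangeRestrict_surjective
  hP.ext X f.ker hker (hP.iso _ _ ⟨(QuotientGroup.quotientKerEquivRange f).symm⟩ hrange)

theorem sup {X : Type} [Group X] [Finite X] {M N : Subgroup X} [N.Normal]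
    (hM : P ↥M) (hN : P ↥N) : P ↥(M ⊔ N) := by
  let f := (QuotientGroup.mk' N).comp (M ⊔ N).subtype
  have hker : f.ker = N.comap (M ⊔ N).subtype := by
    rw [← MonoidHom.comap_ker, QuotientGroup.ker_mk']
  have hrange : f.range = M.map (QuotientGroup.mk' N) := by
    rw [MonoidHom.range_comp, Subgroup.range_subtype, Subgroup.map_sup,
      (Subgroup.map_eq_bot_iff _).2 (QuotientGroup.ker_mk' N).ge, sup_bot_eq]
  refine hP.of_ker_range f ?_ ?_
  · rw [hker]
    exact hP.comap _ (Subgroup.subtype_injective _) hN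
  · rw [hrange]
    exact hP.map _ hM

theorem bot {X : Type} [Group X] [Finite X] : P ↥(⊥ : Subgroup X) :=
  hP.solv _ inferInstance

theorem Op_isP (X : Type) [Group X] [Finite X] : P ↥(Op P X) := by
  obtain ⟨N, hN⟩ := (Set.toFinite {N : Subgroup X | N.Normal ∧ P ↥N}).exists_maximal
    ⟨⊥, inferInstance, hP.bot⟩
  obtain ⟨hNn, hNP⟩ := hN.prop
  refine hP.mono (B := N) ?_ hNP
  rw [Op, genBy_eq_sSup]
  refine sSup_le fun M hM => ?_
  have := hM.1
  exact le_sup_left.trans (hN.le_of_ge ⟨inferInstance, hP.sup hM.2 hNP⟩ le_sup_right)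

theorem Op_characteristic (X : Type) [Group X] [Finite X] : (Op P X).Characteristic := by
  rw [Subgroup.characteristic_iff_map_le]
  intro φ
  exact le_Op ((Op_normal P X).map _ φ.surjective) (hP.map _ (hP.Op_isP X))

theorem subnormal_le_Op {X : Type} [Group X] [Finite X] {W : Subgroup X} (hW : W.IsSubnormal)
    (h : P ↥W) : W ≤ Op P X := by
  have key : (Op P ↥W).map W.subtype ≤ Op P X := by
    clear h
    induction hW with
    | top =>
      exact le_Op ((Op_normal P _).map _ fun x => ⟨⟨x, trivial⟩, rfl⟩) (hP.map _ (hP.Op_isP _))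
    | step H K hle _ hN ih =>
      refine le_trans ?_ ih
      have := hP.Op_characteristic ↥H
      have hmap : (Op P ↥H).map (Subgroup.inclusion hle) ≤ Op P ↥K := by
        refine le_Op ⟨?_⟩ (hP.map _ (hP.Op_isP _))
        rintro _ ⟨x, hx, rfl⟩ k
        let φ : H ≃* H := (Subgroup.subgroupOfEquivOfLe hle).symm.trans
          ((MulAut.conjNormal (H := H.subgroupOf K) k).trans (Subgroup.subgroupOfEquivOfLe hle))
        refine ⟨φ x, Subgroup.characteristic_iff_map_le.1 this φ ⟨x, hx, rfl⟩, ?_⟩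
        ext
        simp [φ]
      refine le_trans ?_ (Subgroup.map_mono hmap)
      rw [Subgroup.map_map, Subgroup.subtype_comp_inclusion]
  have htop : (⊤ : Subgroup W) ≤ Op P W :=
    le_Op inferInstance (hP.iso _ _ ⟨Subgroup.topEquiv.symm⟩ h)
  simpa [top_le_iff.1 htop, ← MonoidHom.range_eq_map] using key

theorem isMinimalNonP_congr {X Y : Type} [Group X] [Group Y] [Finite X] (e : X ≃* Y)
    (h : IsMinimalNonP P X) : IsMinimalNonP P Y := by
  have : Finite Y := Finite.of_equiv _ e.toEquiv
  refine ⟨fun hY => h.1 (hP.iso _ _ ⟨e.symm⟩ hY), fun N hN hne => ?_⟩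
  have hc : N.comap e.toMonoidHom ≠ ⊤ := by
    intro hc
    apply hne
    rw [eq_top_iff]
    intro y _
    have : e.symm y ∈ N.comap e.toMonoidHom := hc ▸ Subgroup.mem_top _
    simpa using this
  have := hP.map e.toMonoidHom (h.2 _ (hN.comap _) hc)
  rwa [Subgroup.map_comap_eq_self_of_surjective e.surjective] at this

theorem commutator_eq_top_of_isMinimalNonP {X : Type} [Group X] [Finite X]
    (h : IsMinimalNonP P X) : commutator X = ⊤ := by
  by_contra hne
  refine h.1 (hP.ext X (commutator X) (h.2 _ inferInstance hne) (hP.solv _ ?_))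
  exact inferInstanceAs (Group.IsSolvable (Abelianization X))

theorem eq_top_of_quotient_of_isMinimalNonP {X : Type} [Group X] [Finite X]
    (h : IsMinimalNonP P X) {N : Subgroup X} (hN : N.Normal) (hQ : P (X ⧸ N)) : N = ⊤ := by
  by_contra hne
  exact h.1 (hP.ext X N (h.2 N hN hne) hQ)

theorem isPComponent_iff {X : Type} [Group X] [Finite X] {K : Subgroup X} :
    IsPComponent P K ↔ K.IsSubnormal ∧ IsMinimalNonP P ↥K := by
  rw [IsPComponent, isSubnormal_iff_subgroup_isSubnormal]
  refine and_congr_right fun _ => ⟨?_, fun h => ⟨?_, ?_⟩⟩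
  · rintro ⟨⟨-, hsimple, a, b, hab⟩, hup⟩
    let q := QuotientGroup.mk' (Op P ↥K)
    let f := (QuotientGroup.mk' (Subgroup.center (↥K ⧸ Op P ↥K))).comp q
    have hf : Function.Surjective f :=
      (QuotientGroup.mk'_surjective _).comp (QuotientGroup.mk'_surjective _)
    have hOup : ∀ N : Subgroup ↥K, ∀ hN : N.Normal, P (↥K ⧸ N) → N = ⊤ := by
      intro N hN hQ
      rw [← top_le_iff, ← hup]
      exact iInf₂_le N ⟨hN, hQ⟩
    have hker : P ↥f.ker := by
      let g := q.comp f.ker.subtype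
      refine hP.of_ker_range g ?_ (hP.solv _ ?_)
      · have hg : g.ker = (Op P ↥K).comap f.ker.subtype :=
          (MonoidHom.comap_ker q f.ker.subtype).symm.trans (by rw [QuotientGroup.ker_mk'])
        rw [hg]
        exact hP.comap _ (Subgroup.subtype_injective _) (hP.Op_isP _)
      · have hle : g.range ≤ Subgroup.center (↥K ⧸ Op P ↥K) := by
          rintro _ ⟨⟨x, hx⟩, rfl⟩
          rwa [← MonoidHom.comap_ker, QuotientGroup.ker_mk'] at hx
        have : Group.IsSolvable ↥(Subgroup.center (↥K ⧸ Op P ↥K)) :=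
          Group.isSolvable_of_comm fun a b => Subtype.ext (Subgroup.mem_center_iff.1 b.2 a)
        exact Group.isSolvable_of_isSolvable_injective (Subgroup.inclusion_injective hle)
    have hnotP : ¬ P ↥K := by
      intro hK
      have hbt := hOup ⊥ inferInstance (hP.quot _ hK _)
      apply hab
      have : Subsingleton ↥K := Subgroup.subsingleton_iff.1 (subsingleton_of_bot_eq_top hbt)
      have := hf.subsingleton
      exact Subsingleton.elim _ _
    refine ⟨hnotP, fun N hN hne => ?_⟩
    rcases (hN.map f hf).eq_bot_or_eq_top with hb | ht
    · exact hP.mono ((Subgroup.map_eq_bot_iff _).1 hb) hker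
    · refine absurd (hOup N hN ?_) hne
      refine hP.of_surjective ((QuotientGroup.mk' N).comp f.ker.subtype) ?_ hker
      intro y
      obtain ⟨x, rfl⟩ := QuotientGroup.mk'_surjective N y
      obtain ⟨n, hn, hnx⟩ : f x ∈ N.map f := ht ▸ Subgroup.mem_top _
      refine ⟨⟨x * n⁻¹, by simp [MonoidHom.mem_ker, hnx]⟩, ?_⟩
      have : QuotientGroup.mk' N n = 1 := (QuotientGroup.eq_one_iff n).2 hn
      rw [MonoidHom.comp_apply, Subgroup.subtype_apply, map_mul, map_inv, this, inv_one, mul_one]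
  · have hne : Op P ↥K ≠ ⊤ := fun ht =>
      h.1 (hP.iso _ _ ⟨Subgroup.topEquiv⟩ (ht ▸ hP.Op_isP ↥K))
    have hnt : Nontrivial (↥K ⧸ Op P ↥K) :=
      (QuotientGroup.nontrivial_iff).2 hne
    have hsimple : IsSimpleGroup (↥K ⧸ Op P ↥K) := by
      refine ⟨fun N hN => ?_⟩
      by_cases hc : N.comap (QuotientGroup.mk' (Op P ↥K)) = ⊤
      · right
        rw [← Subgroup.map_comap_eq_self_of_surjective (QuotientGroup.mk'_surjective (Op P ↥K)) N,
          hc, Subgroup.map_top_of_surjective _ (QuotientGroup.mk'_surjective _)]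
      · left
        rw [← Subgroup.map_comap_eq_self_of_surjective (QuotientGroup.mk'_surjective (Op P ↥K)) N,
          Subgroup.map_eq_bot_iff, QuotientGroup.ker_mk']
        exact le_Op (hN.comap _) (h.2 _ (hN.comap _) hc)
    have hcomm : commutator (↥K ⧸ Op P ↥K) = ⊤ := by
      have := congrArg (Subgroup.map (QuotientGroup.mk' (Op P ↥K)))
        (hP.commutator_eq_top_of_isMinimalNonP h)
      rwa [commutator_def, Subgroup.map_commutator, Subgroup.map_top_of_surjective _
        (QuotientGroup.mk'_surjective _)] at this
    have hcenter : Subgroup.center (↥K ⧸ Op P ↥K) = ⊥ := by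
      refine (Subgroup.Normal.eq_bot_or_eq_top inferInstance).resolve_right fun ht => ?_
      rw [← commutator_eq_bot_iff_center_eq_top, hcomm] at ht
      exact top_ne_bot ht
    have e : (↥K ⧸ Op P ↥K) ≃* (↥K ⧸ Op P ↥K) ⧸ Subgroup.center (↥K ⧸ Op P ↥K) :=
      (QuotientGroup.quotientBot).symm.trans (QuotientGroup.quotientMulEquivOfEq hcenter.symm)
    refine ⟨hcomm, (MulEquiv.isSimpleGroup_congr e).1 hsimple, ?_⟩
    by_contra! hab
    apply top_ne_bot (α := Subgroup (↥K ⧸ Op P ↥K))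
    rw [← hcomm, commutator_eq_bot_iff_center_eq_top, eq_top_iff]
    intro x _
    rw [Subgroup.mem_center_iff]
    intro y
    apply e.injective
    rw [map_mul, map_mul, hab]
  · rw [Oup, eq_top_iff]
    refine le_iInf₂ fun N hN => ?_
    obtain ⟨hN, hQ⟩ := hN
    exact (hP.eq_top_of_quotient_of_isMinimalNonP h hN hQ).ge

theorem not_isP_of_isPComponent {X : Type} [Group X] [Finite X] {K : Subgroup X}
    (hK : IsPComponent P K) : ¬ P ↥K :=
  (hP.isPComponent_iff.1 hK).2.1

theorem commutator_self_of_isPComponent {X : Type} [Group X] [Finite X] {K : Subgroup X}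
    (hK : IsPComponent P K) : ⁅K, K⁆ = K := by
  rw [← Subgroup.map_subtype_commutator,
    hP.commutator_eq_top_of_isMinimalNonP (hP.isPComponent_iff.1 hK).2,
    ← MonoidHom.range_eq_map, Subgroup.range_subtype]

theorem isPComponent_comap {X Y : Type} [Group X] [Group Y] [Finite X] [Finite Y] (f : X →* Y)
    (hf : Function.Injective f) {K : Subgroup Y} (hK : IsPComponent P K) (hle : K ≤ f.range) :
    IsPComponent P (K.comap f) := by
  rw [hP.isPComponent_iff] at hK ⊢
  refine ⟨isSubnormal_comap f hK.1, hP.isMinimalNonP_congr ?_ hK.2⟩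
  exact ((Subgroup.equivMapOfInjective (K.comap f) f hf).trans
    (MulEquiv.subgroupCongr (Subgroup.map_comap_eq_self hle))).symm

theorem isPComponent_map_equiv {X : Type} [Group X] [Finite X] (φ : X ≃* X) {K : Subgroup X}
    (hK : IsPComponent P K) : IsPComponent P (K.map φ.toMonoidHom) := by
  rw [Subgroup.map_equiv_eq_comap_symm']
  exact hP.isPComponent_comap _ φ.symm.injective hK
    fun x _ => φ.symm.surjective x

theorem OPE_normal (X : Type) [Group X] [Finite X] : (OPE P X).Normal := by
  have : (OPE P X).Characteristic := by
    rw [Subgroup.characteristic_iff_map_le]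
    intro φ
    rw [OPE, Subgroup.map_sup, sSup_eq_iSup, Subgroup.map_iSup]
    refine sup_le_sup (Subgroup.characteristic_iff_map_le.1 (hP.Op_characteristic X) φ)
      (iSup_le fun K => ?_)
    rw [Subgroup.map_iSup]
    refine iSup_le fun hK => ?_
    exact le_iSup₂_of_le _ (hP.isPComponent_map_equiv φ hK) le_rfl
  infer_instance

theorem exists_isPComponent_le {X : Type} [Group X] [Finite X] {C : Subgroup X}
    (hC : C.IsSubnormal) (h : ¬ P ↥C) : ∃ K ≤ C, IsPComponent P K := by
  obtain ⟨K, hKC, hK⟩ := (Set.toFinite {K : Subgroup X | K.IsSubnormal ∧ ¬ P ↥K}).exists_le_minimal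
    (show C ∈ _ from ⟨hC, h⟩)
  refine ⟨K, hKC, hP.isPComponent_iff.2 ⟨hK.prop.1, hK.prop.2, fun N hN hne => ?_⟩⟩
  by_contra hNP
  have hle : N.map K.subtype ≤ K := Subgroup.map_subtype_le N
  have := hK.le_of_le (y := N.map K.subtype) ⟨hN.isSubnormal.trans' hK.prop.1, fun hNP' => hNP <|
    hP.iso _ _ ⟨(Subgroup.equivMapOfInjective N K.subtype K.subtype_injective).symm⟩ hNP'⟩ hle
  apply hne
  rw [eq_top_iff]
  intro x _
  obtain ⟨y, hy, hyx⟩ := this x.2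
  rwa [← Subtype.ext hyx]

/-- The centralizer of `O_{𝒫,E}(X)` modulo `O_𝒫(X)` is `O_𝒫(X)`. -/
theorem le_Op_of_commutator_OPE_le {X : Type} [Group X] [Finite X] {T : Subgroup X}
    (h : ⁅T, OPE P X⁆ ≤ Op P X) : T ≤ Op P X := by
  have hE := hP.OPE_normal X
  let q := QuotientGroup.mk' (Op P X)
  have hq : Function.Surjective q := QuotientGroup.mk'_surjective _
  have := hE.map q hq
  let C := (Subgroup.centralizer ((OPE P X).map q : Set (X ⧸ Op P X))).comap q
  have aux : ∀ A : Subgroup X, A ≤ C ↔ ⁅A, OPE P X⁆ ≤ Op P X := by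
    intro A
    rw [← Subgroup.map_le_iff_le_comap, ← Subgroup.commutator_eq_bot_iff_le_centralizer,
      ← Subgroup.map_commutator, Subgroup.map_eq_bot_iff, QuotientGroup.ker_mk']
  have hCn : C.Normal := inferInstance
  refine ((aux T).2 h).trans (le_Op hCn ?_)
  by_contra hC
  obtain ⟨K, hKC, hK⟩ := hP.exists_isPComponent_le hCn.isSubnormal hC
  refine hP.not_isP_of_isPComponent hK (hP.mono ?_ (hP.Op_isP X))
  rw [← hP.commutator_self_of_isPComponent hK]
  have hKE : K ≤ OPE P X := (le_sSup (show K ∈ {K | IsPComponent P K} from hK)).trans le_sup_right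
  exact (Subgroup.commutator_mono le_rfl hKE).trans ((aux K).1 hKC)

theorem isPComponent_le_or_commutator_le {X : Type} [Group X] [Finite X] {K N : Subgroup X}
    (hK : IsPComponent P K) (hN : N.Normal) : K ≤ N ∨ ⁅K, N⁆ ≤ Op P X := by
  obtain ⟨hsub, hmin⟩ := hP.isPComponent_iff.1 hK
  refine or_iff_not_imp_left.2 fun hKN => ?_
  have hNK : P ↥(N.subgroupOf K) :=
    hmin.2 _ inferInstance fun ht => hKN (Subgroup.subgroupOf_eq_top.1 ht)
  have hinf : N ⊓ K ≤ Op P X := by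
    have h1 : ((N.subgroupOf K).map K.subtype).IsSubnormal :=
      (Subgroup.Normal.isSubnormal inferInstance).trans' hsub
    have h2 := hP.subnormal_le_Op h1 (hP.map _ hNK)
    rwa [Subgroup.subgroupOf_map_subtype] at h2
  obtain ⟨n, f, hf, hfn, h0, hn⟩ := Subgroup.IsSubnormal.isSubnormal_iff.1 hsub
  have key : ∀ i, ⁅K, N ⊓ f i⁆ ≤ Op P X := by
    intro i
    induction i with
    | zero =>
      rw [h0, Subgroup.commutator_comm]
      exact commutator_le_of_left_le_normal hinf
    | succ i ih =>
      rw [← hP.commutator_self_of_isPComponent hK]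
      apply commutator_commutator_le_of_le
      refine (Subgroup.commutator_mono le_rfl (le_inf ?_ ?_)).trans ih
      · exact (Subgroup.commutator_mono le_rfl inf_le_left).trans (Subgroup.commutator_le_right _ _)
      · have hnorm : f (i + 1) ≤ Subgroup.normalizer (f i : Set X) :=
          (Subgroup.normal_subgroupOf_iff_le_normalizer (hf (Nat.le_succ i))).1 (hfn i)
        exact (Subgroup.commutator_mono (h0 ▸ hf (Nat.zero_le i)) inf_le_right).trans
          (Subgroup.le_normalizer_iff_commutator_le_left.1 hnorm)
  simpa [hn] using key n

theorem Op_eq_comap_Op {D X : Type} [Group D] [Group X] [Finite D] [Finite X] (f : D →* X)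
    (hf : Function.Injective f) (h : OPE P X ≤ f.range) : Op P D = (Op P X).comap f := by
  have hE := hP.OPE_normal X
  apply le_antisymm
  · rw [← Subgroup.map_le_iff_le_comap]
    apply hP.le_Op_of_commutator_OPE_le
    let W := Op P D ⊓ (OPE P X).comap f
    have hcomm : ⁅Op P D, (OPE P X).comap f⁆ ≤ W := Subgroup.commutator_le_inf _ _
    have hWsub : (W.map f).IsSubnormal := by
      have hWE : W.map f ≤ OPE P X := Subgroup.map_le_iff_le_comap.2 inf_le_right
      refine .step _ _ hWE hE.isSubnormal ⟨?_⟩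
      rintro ⟨_, _⟩ ⟨w, hw, rfl⟩ ⟨y, hy⟩
      obtain ⟨d, rfl⟩ := h hy
      have hWn : W.Normal := inferInstance
      exact ⟨d * w * d⁻¹, hWn.conj_mem w hw d, by simp⟩
    have hWle := hP.subnormal_le_Op hWsub (hP.map f (hP.mono inf_le_left (hP.Op_isP D)))
    refine le_trans ?_ hWle
    rw [← Subgroup.map_comap_eq_self h, ← Subgroup.map_commutator]
    exact Subgroup.map_mono hcomm
  · exact le_Op inferInstance (hP.comap f hf (hP.Op_isP X))

theorem comap_OPE_le_comap_OPE {D X Y : Type} [Group D] [Group X] [Group Y] [Finite D] [Finite X]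
    [Finite Y] (f : D →* X) (hf : Function.Injective f) (g : D →* Y) (hg : Function.Injective g)
    (hX : OPE P X ≤ f.range) (hY : OPE P Y ≤ g.range) :
    (OPE P X).comap f ≤ (OPE P Y).comap g := by
  have hE := hP.OPE_normal Y
  have hfX := hP.Op_eq_comap_Op f hf hX
  have hgY := hP.Op_eq_comap_Op g hg hY
  have hle : OPE P X ≤ ((OPE P Y).comap g).map f := by
    refine sup_le ?_ (sSup_le fun K hK => ?_)
    · rw [← Subgroup.map_comap_eq_self (le_sup_left.trans hX), ← hfX, hgY]
      exact Subgroup.map_mono (Subgroup.comap_mono le_sup_left)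
    · have hKf : K ≤ f.range := (le_sSup hK).trans (le_sup_right.trans hX)
      have hKD := hP.isPComponent_comap f hf hK hKf
      rw [← Subgroup.map_comap_eq_self hKf]
      apply Subgroup.map_mono
      refine (hP.isPComponent_le_or_commutator_le hKD (hE.comap g)).resolve_right fun hc => ?_
      refine hP.not_isP_of_isPComponent hKD (hP.mono ?_ (hP.Op_isP D))
      rw [hgY, ← Subgroup.map_le_iff_le_comap] at hc ⊢
      apply hP.le_Op_of_commutator_OPE_le
      rwa [Subgroup.map_commutator, Subgroup.map_comap_eq_self hY] at hc
  intro x hx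
  obtain ⟨y, hy, hyx⟩ := hle hx
  rwa [← hf hyx]

theorem map_OPE_le_map_OPE {G : Type} [Group G] [Finite G] {H M : Subgroup G}
    (hHM : (OPE P ↥H).map H.subtype ≤ M) (hMH : (OPE P ↥M).map M.subtype ≤ H) :
    (OPE P ↥H).map H.subtype ≤ (OPE P ↥M).map M.subtype := by
  have key := hP.comap_OPE_le_comap_OPE
    (Subgroup.inclusion (inf_le_left : H ⊓ M ≤ H)) (Subgroup.inclusion_injective _)
    (Subgroup.inclusion (inf_le_right : H ⊓ M ≤ M)) (Subgroup.inclusion_injective _)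
    (fun x hx => ⟨⟨x, x.2, hHM ⟨x, hx, rfl⟩⟩, rfl⟩)
    (fun x hx => ⟨⟨x, hMH ⟨x, hx, rfl⟩, x.2⟩, rfl⟩)
  rintro _ ⟨x, hx, rfl⟩
  exact ⟨_, key (x := ⟨x, x.2, hHM ⟨x, hx, rfl⟩⟩) hx, rfl⟩

end IsSolvableClosedClass

end

theorem statement_16
    (P : (X : Type) → [inst : Group X] → Prop)
    (hIso : ∀ (X Y : Type) [Group X] [Group Y] [Finite X], Nonempty (X ≃* Y) → P X → P Y)
    (hSubClosed : ∀ (X : Type) [Group X] [Finite X], P X → ∀ H : Subgroup X, P ↥H)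
    (hQuotClosed : ∀ (X : Type) [Group X] [Finite X], P X → ∀ (N : Subgroup X) [N.Normal], P (X ⧸ N))
    (hExtClosed : ∀ (X : Type) [Group X] [Finite X] (N : Subgroup X) [N.Normal],
      P ↥N → P (X ⧸ N) → P X)
    (hSolvP : ∀ (X : Type) [Group X] [Finite X], IsSolvable X → P X)
    (G : Type) [Group G] [Finite G] (H M : Subgroup G)
    (hHM : (OPE P ↥H).map H.subtype ≤ M) (hMH : (OPE P ↥M).map M.subtype ≤ H) :
    (OPE P ↥H).map H.subtype = (OPE P ↥M).map M.subtype := by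
  have hP : IsSolvableClosedClass P := ⟨hIso, hSubClosed, hQuotClosed, hExtClosed, hSolvP⟩
  exact le_antisymm (hP.map_OPE_le_map_OPE hHM hMH) (hP.map_OPE_le_map_OPE hMH hHM)

end PaperPF
end
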